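/- arXiv:1912.05608 — 2 statements merged into one kernel-verified Lean document; each statement's English description precedes it below -/
import Mathlib

section
/- Assume M is ∞-spanned and the indexing of the generators is adapted as in the Labelling lemma. Then the greatest common divisor of the set of lengths of all directed cycles in the geodesic automaton Geo equals 1; that is, gcd { l ≥ 1 : there exist a reachable non-fail state D and a word u of length l over {1, …, n} with all transitions defined and δ̂(D, u) = D } = 1 (in particular this set is nonempty). -/
open scoped BigOperators

/-- The simple root `α_i`, the `i`-th standard basis vector of `ℝ^n`. -/
noncomputable def simpleRoot {n : ℕ} (i : Fin n) : Fin n → ℝ := Pi.single i 1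

/-- The symmetric bilinear form `B` associated to the Coxeter matrix `M`, determined by
`B(α_i, α_j) = -cos (π / M i j)` when `M i j ≠ 0` and `B(α_i, α_j) = -1` when
`M i j = 0` (the label `∞`). -/
noncomputable def bform {n : ℕ} (M : CoxeterMatrix (Fin n)) (u v : Fin n → ℝ) : ℝ :=
  ∑ i, ∑ j, u i * (if M i j = 0 then -1 else -Real.cos (Real.pi / (M i j))) * v j

/-- The simple reflection `σ_i(v) = v - 2 B(v, α_i) α_i`. -/
noncomputable def simpleRefl {n : ℕ} (M : CoxeterMatrix (Fin n)) (i : Fin n)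
    (v : Fin n → ℝ) : Fin n → ℝ :=
  v - (2 * bform M v (simpleRoot i)) • simpleRoot i

/-- The set `Σ` of small roots of `M`: the smallest set of vectors containing the simple
roots `α_1, …, α_n` and such that whenever `v ∈ Σ` and `-1 < B(v, α_i) < 0`, also
`σ_i(v) ∈ Σ`. -/
inductive IsSmallRoot {n : ℕ} (M : CoxeterMatrix (Fin n)) : (Fin n → ℝ) → Prop
  | simple (i : Fin n) : IsSmallRoot M (simpleRoot i)
  | reflect {v : Fin n → ℝ} (i : Fin n) : IsSmallRoot M v →
      -1 < bform M v (simpleRoot i) → bform M v (simpleRoot i) < 0 →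
      IsSmallRoot M (simpleRefl M i v)

/-- The transition function of the geodesic automaton `Geo` (defined when `α_i ∉ D`):
`δ(D, i) = {α_i} ∪ (σ_i(D) ∩ Σ)`. -/
noncomputable def stepGeo {n : ℕ} (M : CoxeterMatrix (Fin n)) (D : Set (Fin n → ℝ))
    (i : Fin n) : Set (Fin n → ℝ) :=
  insert (simpleRoot i) (simpleRefl M i '' D ∩ {v | IsSmallRoot M v})

/-- The transition function of the shortlex automaton `ShortLex` (defined when `α_i ∉ D`):
`δ(D, i) = {α_i} ∪ ((σ_i(D) ∪ {σ_i(α_l) : l < i}) ∩ Σ)`. -/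
noncomputable def stepSL {n : ℕ} (M : CoxeterMatrix (Fin n)) (D : Set (Fin n → ℝ))
    (i : Fin n) : Set (Fin n → ℝ) :=
  insert (simpleRoot i)
    ((simpleRefl M i '' D ∪ simpleRefl M i '' {v | ∃ l : Fin n, l < i ∧ v = simpleRoot l})
      ∩ {v | IsSmallRoot M v})

/-- All transitions of the automaton with transition function `step` are defined (do not
fail) when reading the word `u` from the state `D`; a transition out of `D` along the letter
`i` is defined exactly when `α_i ∉ D`. -/
def DefinedFrom {n : ℕ} (step : Set (Fin n → ℝ) → Fin n → Set (Fin n → ℝ)) :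
    Set (Fin n → ℝ) → List (Fin n) → Prop
  | _, [] => True
  | D, i :: u => simpleRoot i ∉ D ∧ DefinedFrom step (step D i) u

/-- The enhanced transition function `δ̂(D, u)`: the state obtained by reading the word `u`
from the state `D`. -/
def run {n : ℕ} (step : Set (Fin n → ℝ) → Fin n → Set (Fin n → ℝ))
    (D : Set (Fin n → ℝ)) (u : List (Fin n)) : Set (Fin n → ℝ) :=
  u.foldl step D

/-- A state is reachable if it is obtained from the start state `∅` by reading some word all
of whose transitions are defined. -/
def Reachable {n : ℕ} (step : Set (Fin n → ℝ) → Fin n → Set (Fin n → ℝ))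
    (D : Set (Fin n → ℝ)) : Prop :=
  ∃ u : List (Fin n), DefinedFrom step ∅ u ∧ run step ∅ u = D

/-- The graph of `∞`-edges of the Coxeter matrix `M`: `i ≠ j` are adjacent iff `M i j = 0`. -/
def infGraph {n : ℕ} (M : CoxeterMatrix (Fin n)) : SimpleGraph (Fin n) :=
  SimpleGraph.fromRel (fun i j => M i j = 0)

/-- The indexing of the generators is adapted as in the Labelling lemma: there is a spanning
tree `Γ` of the graph of `∞`-edges containing the edges `{1,2}` and `{2,3}`, such that along
every simple path in `Γ` from the vertex `1` to a leaf of `Γ` the labels strictly increase.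
(Vertices `1, 2, 3` correspond to the indices `0, 1, 2` of `Fin n`.) -/
def AdaptedLabelling {n : ℕ} (hn : 3 ≤ n) (M : CoxeterMatrix (Fin n)) : Prop :=
  ∃ Γ : SimpleGraph (Fin n), Γ ≤ infGraph M ∧ Γ.Connected ∧ Γ.IsAcyclic ∧
    Γ.Adj ⟨0, by omega⟩ ⟨1, by omega⟩ ∧ Γ.Adj ⟨1, by omega⟩ ⟨2, by omega⟩ ∧
    ∀ (v : Fin n) (p : Γ.Walk ⟨0, by omega⟩ v), p.IsPath → (∃! w : Fin n, Γ.Adj v w) →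
      p.support.Chain' (· < ·)

/-- The entry `B(α_i, α_j)` of the Gram matrix of the form `B`. -/
noncomputable def gramEntry {n : ℕ} (M : CoxeterMatrix (Fin n)) (i j : Fin n) : ℝ :=
  if M i j = 0 then -1 else -Real.cos (Real.pi / (M i j))

theorem bform_simpleRoot {n : ℕ} (M : CoxeterMatrix (Fin n)) (v : Fin n → ℝ) (i : Fin n) :
    bform M v (simpleRoot i) = ∑ k, v k * gramEntry M k i := by
  simp [bform, simpleRoot, gramEntry, Pi.single_apply]

theorem two_le_of_ne {n : ℕ} (M : CoxeterMatrix (Fin n)) {i j : Fin n} (hij : i ≠ j)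
    (h : M i j ≠ 0) : 2 ≤ M i j := by
  have := M.off_diagonal i j hij
  omega

theorem gramEntry_nonpos {n : ℕ} (M : CoxeterMatrix (Fin n)) {i j : Fin n} (hij : i ≠ j) :
    gramEntry M i j ≤ 0 := by
  unfold gramEntry
  split_ifs with h
  · norm_num
  · have h2 : (2 : ℝ) ≤ M i j := by exact_mod_cast two_le_of_ne M hij h
    have hle : Real.pi / (M i j) ≤ Real.pi / 2 :=
      div_le_div_of_nonneg_left Real.pi_pos.le (by norm_num) h2
    have hpos : 0 ≤ Real.pi / (M i j) := by positivity
    linarith [Real.cos_nonneg_of_neg_pi_div_two_le_of_le (by linarith [Real.pi_pos]) hle]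

/-- A negative off-diagonal Gram entry is at most `-1/2`. -/
theorem gramEntry_le_neg_half {n : ℕ} (M : CoxeterMatrix (Fin n)) {i j : Fin n} (hij : i ≠ j)
    (h : gramEntry M i j ≠ 0) : gramEntry M i j ≤ -(1 / 2) := by
  unfold gramEntry at h ⊢
  split_ifs at h ⊢ with h0
  · norm_num
  · have h2 := two_le_of_ne M hij h0
    have hne : M i j ≠ 2 := fun h' => h (by simp [h'])
    have h3 : (3 : ℝ) ≤ M i j := by exact_mod_cast (by omega : 3 ≤ M i j)
    have hle : Real.pi / (M i j) ≤ Real.pi / 3 :=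
      div_le_div_of_nonneg_left Real.pi_pos.le (by norm_num) h3
    have hcos := Real.cos_le_cos_of_nonneg_of_le_pi (x := Real.pi / (M i j))
      (y := Real.pi / 3) (by positivity) (by linarith [Real.pi_pos]) hle
    rw [Real.cos_pi_div_three] at hcos
    linarith

/-- If `v ≥ 0` has vanishing `i`-th coordinate, then `B(v, α_i)` is bounded above by each of
its summands. -/
theorem bform_simpleRoot_le {n : ℕ} (M : CoxeterMatrix (Fin n)) {v : Fin n → ℝ} {i : Fin n}
    (hv : ∀ k, 0 ≤ v k) (hi : v i = 0) (j : Fin n) :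
    bform M v (simpleRoot i) ≤ v j * gramEntry M j i := by
  rw [bform_simpleRoot]
  have hterm : ∀ k, v k * gramEntry M k i ≤ 0 := fun k => by
    by_cases hk : k = i
    · simp [hk, hi]
    · exact mul_nonpos_of_nonneg_of_nonpos (hv k) (gramEntry_nonpos M hk)
  rw [← Finset.add_sum_erase _ _ (Finset.mem_univ j)]
  linarith [Finset.sum_nonpos fun k (_ : k ∈ Finset.univ.erase j) => hterm k]

theorem simpleRefl_apply_self {n : ℕ} (M : CoxeterMatrix (Fin n)) (i : Fin n)
    (v : Fin n → ℝ) : simpleRefl M i v i = v i - 2 * bform M v (simpleRoot i) := by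
  simp [simpleRefl, simpleRoot]

theorem simpleRefl_apply_of_ne {n : ℕ} (M : CoxeterMatrix (Fin n)) {i j : Fin n}
    (h : j ≠ i) (v : Fin n → ℝ) : simpleRefl M i v j = v j := by
  simp [simpleRefl, simpleRoot, h]

/-- The nonzero coordinates of a small root are at least `1`, and its support contains no
`∞`-edge. -/
theorem IsSmallRoot.coord_and_support {n : ℕ} {M : CoxeterMatrix (Fin n)} {v : Fin n → ℝ}
    (hv : IsSmallRoot M v) :
    (∀ k, v k = 0 ∨ 1 ≤ v k) ∧ ∀ j k, v j ≠ 0 → v k ≠ 0 → M j k ≠ 0 := by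
  induction hv with
  | simple i =>
    refine ⟨fun k => ?_, fun j k hj hk => ?_⟩
    · by_cases h : k = i <;> simp [simpleRoot, h]
    · have hj' : j = i := by by_contra h; simp [simpleRoot, h] at hj
      have hk' : k = i := by by_contra h; simp [simpleRoot, h] at hk
      simp [hj', hk']
  | @reflect v i _ hlow hneg ih =>
    obtain ⟨hcoord, hsupp⟩ := ih
    have hnonneg : ∀ k, 0 ≤ v k := fun k => by rcases hcoord k with h | h <;> linarith
    have hedge : ∀ j, j ≠ i → v j ≠ 0 → M j i ≠ 0 := by
      intro j hj hvj hM
      by_cases hi : v i = 0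
      · have hle := bform_simpleRoot_le M hnonneg hi j
        have h1 := (hcoord j).resolve_left hvj
        simp only [gramEntry, hM, if_true] at hle
        linarith
      · exact hsupp j i hvj hi hM
    refine ⟨fun k => ?_, fun j k hj hk => ?_⟩
    · by_cases hk : k = i
      · subst hk
        right
        rw [simpleRefl_apply_self]
        rcases hcoord k with hi | hi
        · obtain ⟨j, hj⟩ : ∃ j, v j * gramEntry M j k ≠ 0 := by
            by_contra! hall
            rw [bform_simpleRoot, Finset.sum_eq_zero fun j _ => hall j] at hneg
            exact lt_irrefl _ hneg
          have hvj := left_ne_zero_of_mul hj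
          have hjk : j ≠ k := fun h => hvj (h ▸ hi)
          have hg := gramEntry_le_neg_half M hjk (right_ne_zero_of_mul hj)
          have h1 := (hcoord j).resolve_left hvj
          have hle := bform_simpleRoot_le M hnonneg hi j
          nlinarith
        · linarith
      · rw [simpleRefl_apply_of_ne M hk]
        exact hcoord k
    · by_cases hji : j = i <;> by_cases hki : k = i
      · simp [hji, hki]
      · rw [simpleRefl_apply_of_ne M hki] at hk
        rw [hji, M.symmetric]
        exact hedge k hki hk
      · rw [simpleRefl_apply_of_ne M hji] at hj
        rw [hki]
        exact hedge j hji hj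
      · rw [simpleRefl_apply_of_ne M hji] at hj
        rw [simpleRefl_apply_of_ne M hki] at hk
        exact hsupp j k hj hk

/-- Reflecting a nonnegative vector across an `∞`-edge leaving its support never gives a
small root. -/
theorem not_isSmallRoot_simpleRefl {n : ℕ} {M : CoxeterMatrix (Fin n)} {v : Fin n → ℝ}
    {i j : Fin n} (hv : ∀ k, 0 ≤ v k) (hi : v i = 0) (hj : 0 < v j) (hM : M j i = 0) :
    ¬ IsSmallRoot M (simpleRefl M i v) := by
  intro hsmall
  have hji : j ≠ i := fun h => hj.ne' (h ▸ hi)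
  refine hsmall.coord_and_support.2 j i ?_ ?_ hM
  · rw [simpleRefl_apply_of_ne M hji]
    exact hj.ne'
  · rw [simpleRefl_apply_self, hi]
    have hle := bform_simpleRoot_le M hv hi j
    simp only [gramEntry, hM, if_true] at hle
    linarith

theorem stepGeo_eq_singleton {n : ℕ} {M : CoxeterMatrix (Fin n)} {D : Set (Fin n → ℝ)}
    {i : Fin n} (hD : ∀ v ∈ D, (∀ k, 0 ≤ v k) ∧ v i = 0 ∧ ∃ j, 0 < v j ∧ M j i = 0) :
    stepGeo M D i = {simpleRoot i} := by
  have hempty : simpleRefl M i '' D ∩ {v | IsSmallRoot M v} = ∅ := by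
    rw [Set.eq_empty_iff_forall_notMem]
    rintro _ ⟨⟨v, hvD, rfl⟩, hsmall⟩
    obtain ⟨hv, hi, j, hj, hM⟩ := hD v hvD
    exact not_isSmallRoot_simpleRefl hv hi hj hM hsmall
  rw [stepGeo, hempty, insert_empty_eq]

theorem simpleRoot_nonneg {n : ℕ} (i k : Fin n) : 0 ≤ (simpleRoot i : Fin n → ℝ) k := by
  by_cases h : k = i <;> simp [simpleRoot, h]

theorem simpleRoot_apply_self {n : ℕ} (i : Fin n) : (simpleRoot i : Fin n → ℝ) i = 1 := by
  simp [simpleRoot]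

theorem simpleRoot_apply_of_ne {n : ℕ} {i k : Fin n} (h : k ≠ i) :
    (simpleRoot i : Fin n → ℝ) k = 0 := by
  simp [simpleRoot, h]

theorem simpleRoot_notMem {n : ℕ} {D : Set (Fin n → ℝ)} {i : Fin n}
    (hD : ∀ v ∈ D, v i = 0) : simpleRoot i ∉ D := fun h => by
  simpa [simpleRoot] using hD _ h

theorem stepGeo_singleton_of_inf {n : ℕ} {M : CoxeterMatrix (Fin n)} {i j : Fin n}
    (hji : j ≠ i) (hM : M j i = 0) : stepGeo M {simpleRoot j} i = {simpleRoot i} := by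
  refine stepGeo_eq_singleton ?_
  rintro v rfl
  exact ⟨simpleRoot_nonneg j, simpleRoot_apply_of_ne hji.symm, j,
    by rw [simpleRoot_apply_self]; exact one_pos, hM⟩

/-- For `∞`-edges `{a, b}` and `{c, b}`, reading `b` after `a` resets the state `{α_c}` to
`{α_b}`. -/
theorem stepGeo_singleton_pair {n : ℕ} {M : CoxeterMatrix (Fin n)} {a b c : Fin n}
    (hab : a ≠ b) (hcb : c ≠ b) (hca : c ≠ a) (hMab : M a b = 0) (hMcb : M c b = 0) :
    simpleRoot b ∉ stepGeo M {simpleRoot c} a ∧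
      stepGeo M (stepGeo M {simpleRoot c} a) b = {simpleRoot b} := by
  have hD : ∀ v ∈ stepGeo M {simpleRoot c} a,
      (∀ k, 0 ≤ v k) ∧ v b = 0 ∧ ∃ j, 0 < v j ∧ M j b = 0 := by
    rintro v (rfl | ⟨⟨_, rfl, rfl⟩, -⟩)
    · exact ⟨simpleRoot_nonneg a, simpleRoot_apply_of_ne hab.symm, a,
        by rw [simpleRoot_apply_self]; exact one_pos, hMab⟩
    · refine ⟨fun k => ?_, ?_, c, ?_, hMcb⟩
      · by_cases hk : k = a
        · subst hk
          have h0 : (simpleRoot c : Fin n → ℝ) k = 0 := simpleRoot_apply_of_ne hca.symm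
          have hle := bform_simpleRoot_le M (simpleRoot_nonneg c) h0 k
          rw [h0, zero_mul] at hle
          rw [simpleRefl_apply_self, h0]
          linarith
        · rw [simpleRefl_apply_of_ne M hk]
          exact simpleRoot_nonneg c k
      · rw [simpleRefl_apply_of_ne M hab.symm, simpleRoot_apply_of_ne hcb.symm]
      · rw [simpleRefl_apply_of_ne M hca, simpleRoot_apply_self]
        exact one_pos
  exact ⟨simpleRoot_notMem fun v hv => (hD v hv).2.1, stepGeo_eq_singleton hD⟩

theorem simpleRoot_notMem_singleton {n : ℕ} {i j : Fin n} (h : i ≠ j) :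
    simpleRoot i ∉ ({simpleRoot j} : Set (Fin n → ℝ)) :=
  simpleRoot_notMem (by rintro v rfl; exact simpleRoot_apply_of_ne h)

theorem reachable_singleton {n : ℕ} (M : CoxeterMatrix (Fin n)) (i : Fin n) :
    Reachable (stepGeo M) {simpleRoot i} :=
  ⟨[i], by simp [DefinedFrom], by simp [run, stepGeo]⟩

theorem coxeter_eq_zero_of_adj {n : ℕ} {M : CoxeterMatrix (Fin n)} {i j : Fin n}
    (h : (infGraph M).Adj i j) : M i j = 0 := by
  rw [infGraph, SimpleGraph.fromRel_adj] at h
  rcases h.2 with h | h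
  · exact h
  · rw [M.symmetric]
    exact h

/-- **GCD lemma** for the geo automaton: if `M` is `∞`-spanned and the indexing is
adapted as in the Labelling lemma, then the set of lengths of directed cycles of the
automaton (through reachable non-fail states) is nonempty and its greatest common divisor is
`1`, i.e. the only natural number dividing all cycle lengths is `1`. -/
theorem gcd_cycles_geo {n : ℕ} (hn : 3 ≤ n) (M : CoxeterMatrix (Fin n))
    (hspan : (infGraph M).Connected) (hadapt : AdaptedLabelling hn M) :
    {l : ℕ | 1 ≤ l ∧ ∃ (D : Set (Fin n → ℝ)) (u : List (Fin n)),
        Reachable (stepGeo M) D ∧ u.length = l ∧ DefinedFrom (stepGeo M) D u ∧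
        run (stepGeo M) D u = D}.Nonempty ∧
    ∀ d : ℕ, (∀ l ∈ {l : ℕ | 1 ≤ l ∧ ∃ (D : Set (Fin n → ℝ)) (u : List (Fin n)),
        Reachable (stepGeo M) D ∧ u.length = l ∧ DefinedFrom (stepGeo M) D u ∧
        run (stepGeo M) D u = D}, d ∣ l) → d = 1 := by
  obtain ⟨Γ, hΓ, -, -, hadj01, hadj12, -⟩ := hadapt
  obtain ⟨a, ha⟩ : ∃ a : Fin n, a = ⟨0, by omega⟩ := ⟨_, rfl⟩
  obtain ⟨b, hb⟩ : ∃ b : Fin n, b = ⟨1, by omega⟩ := ⟨_, rfl⟩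
  obtain ⟨c, hc⟩ : ∃ c : Fin n, c = ⟨2, by omega⟩ := ⟨_, rfl⟩
  rw [← ha, ← hb] at hadj01
  rw [← hb, ← hc] at hadj12
  have hca : c ≠ a := by simp [ha, hc]
  have hab := hadj01.ne
  have hbc := hadj12.ne
  have hMab := coxeter_eq_zero_of_adj (hΓ hadj01)
  have hMba := coxeter_eq_zero_of_adj (hΓ hadj01.symm)
  have hMbc := coxeter_eq_zero_of_adj (hΓ hadj12)
  have hMcb := coxeter_eq_zero_of_adj (hΓ hadj12.symm)
  have hstep_ba := stepGeo_singleton_of_inf hab.symm hMba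
  have hstep_ab := stepGeo_singleton_of_inf hab hMab
  have hstep_bc := stepGeo_singleton_of_inf hbc hMbc
  obtain ⟨hdef, hreset⟩ := stepGeo_singleton_pair hab hbc.symm hca hMab hMcb
  have htwo : 2 ∈ {l : ℕ | 1 ≤ l ∧ ∃ (D : Set (Fin n → ℝ)) (u : List (Fin n)),
      Reachable (stepGeo M) D ∧ u.length = l ∧ DefinedFrom (stepGeo M) D u ∧
      run (stepGeo M) D u = D} := by
    refine ⟨by norm_num, {simpleRoot b}, [a, b], reachable_singleton M b, rfl,
      ⟨simpleRoot_notMem_singleton hab, ?_, trivial⟩, ?_⟩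
    · rw [hstep_ba]
      exact simpleRoot_notMem_singleton hab.symm
    · simp only [run, List.foldl_cons, List.foldl_nil, hstep_ba, hstep_ab]
  have hthree : 3 ∈ {l : ℕ | 1 ≤ l ∧ ∃ (D : Set (Fin n → ℝ)) (u : List (Fin n)),
      Reachable (stepGeo M) D ∧ u.length = l ∧ DefinedFrom (stepGeo M) D u ∧
      run (stepGeo M) D u = D} := by
    refine ⟨by norm_num, {simpleRoot b}, [c, a, b], reachable_singleton M b, rfl,
      ⟨simpleRoot_notMem_singleton hbc.symm, ?_, ?_, trivial⟩, ?_⟩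
    · rw [hstep_bc]
      exact simpleRoot_notMem_singleton hca.symm
    · rw [hstep_bc]
      exact hdef
    · simp only [run, List.foldl_cons, List.foldl_nil, hstep_bc, hreset]
  refine ⟨⟨2, htwo⟩, fun d hd => ?_⟩
  simpa using Nat.dvd_sub (hd 3 hthree) (hd 2 htwo)
end

section
/- Assume M 1 2 = 0, M 2 3 = 0, and m = M 1 3 ≥ 2 (so m is finite). Define words over the generators: if m is even, w = s_1 s_2 (s_1 s_3)^{m/2} and w'' = s_1 s_2 (s_3 s_1)^{m/2}; if m is odd, w = s_1 s_2 (s_1 s_3)^{(m−1)/2} s_1 and w'' = s_1 s_2 (s_3 s_1)^{(m−1)/2} s_3. Then w and w'' are distinct words of length m + 2 that represent the same element of G, and both are geodesic (reduced) words: the word length of the element they represent equals m + 2. In particular, some element of G has at least two distinct reduced expressions, so the geodesic language of (G, S) strictly contains the shortlex language. -/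
/-- A Coxeter matrix is `∞`-spanned if the simple graph on its index set, with an edge joining
`i ≠ j` exactly when `M i j = 0` (the label `∞`), is connected. -/
def CoxeterMatrix.InfSpanned {n : ℕ} (M : CoxeterMatrix (Fin n)) : Prop :=
  (SimpleGraph.fromRel (fun i j => M i j = 0)).Connected

/-- `w_k`: the number of elements of the Coxeter group of word length `k`. -/
noncomputable def wordCount {n : ℕ} {W : Type*} [Group W] {M : CoxeterMatrix (Fin n)}
    (cs : CoxeterSystem M W) (k : ℕ) : ℕ :=
  Nat.card {g : W // cs.length g = k}

/-- `g_k`: the number of geodesic words of length `k`, i.e. tuples `(i_1, …, i_k)` such that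
the word `s_{i_1} ⋯ s_{i_k}` is reduced. -/
noncomputable def geoCount {n : ℕ} {W : Type*} [Group W] {M : CoxeterMatrix (Fin n)}
    (cs : CoxeterSystem M W) (k : ℕ) : ℕ :=
  Nat.card {l : List (Fin n) // l.length = k ∧ cs.length (cs.wordProd l) = k}

/-- The word growth rate `ω(G) = limsup_k w_k^(1/k)`. -/
noncomputable def wordGrowthRate {n : ℕ} {W : Type*} [Group W] {M : CoxeterMatrix (Fin n)}
    (cs : CoxeterSystem M W) : ℝ :=
  Filter.limsup (fun k : ℕ => (wordCount cs k : ℝ) ^ ((k : ℝ)⁻¹)) Filter.atTop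

/-- The geodesic growth rate `γ(G) = limsup_k g_k^(1/k)`. -/
noncomputable def geoGrowthRate {n : ℕ} {W : Type*} [Group W] {M : CoxeterMatrix (Fin n)}
    (cs : CoxeterSystem M W) : ℝ :=
  Filter.limsup (fun k : ℕ => (geoCount cs k : ℝ) ^ ((k : ℝ)⁻¹)) Filter.atTop

/-- The word `(s_a s_b)^k`, as a list of generator indices. -/
def altPairs {n : ℕ} (a b : Fin n) (k : ℕ) : List (Fin n) := (List.replicate k [a, b]).flatten

/-- The word `w`: if `m` is even, `w = s_a s_b (s_a s_c)^(m/2)`; if `m` is odd,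
`w = s_a s_b (s_a s_c)^((m-1)/2) s_a`. -/
def wWord {n : ℕ} (a b c : Fin n) (m : ℕ) : List (Fin n) :=
  if m % 2 = 0 then [a, b] ++ altPairs a c (m / 2)
  else [a, b] ++ altPairs a c ((m - 1) / 2) ++ [a]

/-- The word `w''`: if `m` is even, `w'' = s_a s_b (s_c s_a)^(m/2)`; if `m` is odd,
`w'' = s_a s_b (s_c s_a)^((m-1)/2) s_c`. -/
def wWord'' {n : ℕ} (a b c : Fin n) (m : ℕ) : List (Fin n) :=
  if m % 2 = 0 then [a, b] ++ altPairs c a (m / 2)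
  else [a, b] ++ altPairs c a ((m - 1) / 2) ++ [c]

open CoxeterSystem Module Polynomial

/-- For a primitive root of unity `ζ` of order at least `3`, the three distinct roots `ζ`, `ζ⁻¹`, `1`
of `X ^ m - 1` split off. -/
theorem mul_X_sub_C_dvd_X_pow_sub_one {m : ℕ} (hm : 3 ≤ m) {ζ : ℂ} (hζ : IsPrimitiveRoot ζ m) :
    (X - C ζ) * (X - C ζ⁻¹) * (X - C 1) ∣ (X ^ m - 1 : ℂ[X]) := by
  have h0 : ζ ≠ 0 := hζ.ne_zero (by omega)
  have h1 : ζ ≠ 1 := hζ.ne_one (by omega)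
  have h2 : ζ ≠ ζ⁻¹ := by
    intro h
    have : ζ ^ 2 = 1 := by rw [pow_two]; nth_rewrite 2 [h]; exact mul_inv_cancel₀ h0
    have := Nat.le_of_dvd two_pos (hζ.dvd_of_pow_eq_one 2 this)
    omega
  have h3 : ζ⁻¹ ≠ 1 := by simpa using h1
  have key : ∀ z : ℂ, z ^ m = 1 → (X - C z) ∣ (X ^ m - 1 : ℂ[X]) := by
    intro z hz
    rw [dvd_iff_isRoot]
    simp [hz]
  have cop : ∀ {a b : ℂ}, a ≠ b → IsCoprime (X - C a) (X - C b) := fun h =>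
    isCoprime_X_sub_C_of_isUnit_sub (sub_ne_zero.2 h).isUnit
  refine IsCoprime.mul_dvd (IsCoprime.mul_left (cop h1) (cop h3)) ?_ (key 1 (one_pow _))
  exact (cop h2).mul_dvd (key ζ hζ.pow_eq_one) (key _ (by rw [inv_pow, hζ.pow_eq_one, inv_one]))

/-- The product of two reflections whose mutual pairings are `-(ξ + ξ⁻¹)`, with `ξ ^ 2` a primitive
`m`-th root of unity, has order dividing `m`. -/
theorem preReflection_mul_preReflection_pow_eq_one {V : Type*} [AddCommGroup V] [Module ℂ V]
    {x y : V} {f g : Dual ℂ V} {ξ : ℂ} {m : ℕ} (hm : 2 ≤ m) (hξ : IsPrimitiveRoot (ξ ^ 2) m)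
    (hfx : f x = 2) (hgy : g y = 2) (hfy : f y = -(ξ + ξ⁻¹)) (hgx : g x = -(ξ + ξ⁻¹)) :
    (preReflection x f * preReflection y g) ^ m = 1 := by
  have h0 : ξ ≠ 0 := by
    rintro rfl
    exact hξ.ne_zero (by omega) (by simp)
  obtain rfl | hm := hm.eq_or_lt
  · have h : ξ + ξ⁻¹ = 0 := by
      have := hξ.eq_neg_one_of_two_right
      field_simp
      linear_combination this
    rw [h, neg_zero] at hfy hgx
    ext v
    simp only [pow_two, Module.End.mul_apply, preReflection_apply, map_sub, map_smul, hfx, hfy,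
      hgx, hgy, Module.End.one_apply]
    module
  · obtain ⟨q, hq⟩ := mul_X_sub_C_dvd_X_pow_sub_one hm hξ
    have hP : aeval (preReflection x f * preReflection y g)
        ((X - C (ξ ^ 2)) * (X - C (ξ ^ 2)⁻¹) * (X - C 1)) = 0 := by
      ext v
      simp only [map_mul, map_sub, aeval_X, aeval_C, Module.End.mul_apply, preReflection_apply,
        LinearMap.sub_apply, Module.algebraMap_end_apply, map_smul, hfx, hfy,
        hgx, hgy, LinearMap.zero_apply]
      match_scalars <;> field_simp <;> ring
    have := congrArg (aeval (preReflection x f * preReflection y g)) hq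
    rw [map_mul, hP, zero_mul] at this
    simpa [sub_eq_zero] using this

namespace CoxeterMatrix
variable {B : Type*} (M : CoxeterMatrix B)

/-- The number `exp (π i / m)` for the label `m = M i j`; it is `1` when the label is `∞`. -/
noncomputable def halfRoot (i j : B) : ℂ := Complex.exp (Real.pi * Complex.I / M i j)

theorem isPrimitiveRoot_halfRoot_sq {i j : B} (h : M i j ≠ 0) :
    IsPrimitiveRoot (M.halfRoot i j ^ 2) (M i j) := by
  convert Complex.isPrimitiveRoot_exp (M i j) h using 1
  rw [halfRoot, ← Complex.exp_nat_mul]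
  congr 1
  push_cast; ring

variable [Fintype B]

/-- The functional pairing the `j`-th basis vector to `-2 cos (π / M i j)`. -/
noncomputable def coroot (i : B) : Dual ℂ (B → ℂ) :=
  ∑ j, (-(M.halfRoot i j + (M.halfRoot i j)⁻¹)) • LinearMap.proj j

variable [DecidableEq B]

theorem coroot_single (i j : B) :
    M.coroot i (Pi.single j 1) = -(M.halfRoot i j + (M.halfRoot i j)⁻¹) := by
  simp [coroot, Pi.single_apply]

theorem coroot_single_self (i : B) : M.coroot i (Pi.single i 1) = 2 := by
  rw [coroot_single]
  simp [halfRoot]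
  norm_num

/-- The reflection in the `i`-th basis vector in the geometric representation. -/
noncomputable def geomReflection (i : B) : End ℂ (B → ℂ) :=
  preReflection (Pi.single i 1) (M.coroot i)

theorem isLiftable_geomReflection : M.IsLiftable M.geomReflection := by
  intro i j
  obtain rfl | hij := eq_or_ne i j
  · rw [M.diagonal, pow_one]
    refine LinearMap.ext fun v => ?_
    exact involutive_preReflection (M.coroot_single_self i) _
  · obtain h0 | h0 := eq_or_ne (M i j) 0
    · rw [h0, pow_zero]
    · have h1 := M.off_diagonal i j hij
      refine preReflection_mul_preReflection_pow_eq_one (by omega)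
        (M.isPrimitiveRoot_halfRoot_sq h0) (M.coroot_single_self i) (M.coroot_single_self j)
        (M.coroot_single i j) ?_
      rw [coroot_single, halfRoot, halfRoot, M.symmetric]

end CoxeterMatrix

namespace CoxeterSystem
variable {B W : Type*} [Group W] {M : CoxeterMatrix B} (cs : CoxeterSystem M W)

section GeometricRepresentation
variable [Fintype B] [DecidableEq B]

/-- The geometric representation of a Coxeter group, with complex coefficients. -/
noncomputable def geomRep : W →* End ℂ (B → ℂ) := cs.lift ⟨_, M.isLiftable_geomReflection⟩

theorem geomRep_simple_apply (i : B) (v : B → ℂ) :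
    cs.geomRep (cs.simple i) v = v - M.coroot i v • Pi.single i 1 := by
  rw [geomRep, lift_apply_simple, CoxeterMatrix.geomReflection, preReflection_apply]

theorem geomRep_simple_single_self (i : B) :
    cs.geomRep (cs.simple i) (Pi.single i 1) = -Pi.single i 1 := by
  rw [geomRep_simple_apply, M.coroot_single_self, two_smul]
  abel

theorem geomRep_simple_single_of_eq_zero {i j : B} (h : M i j = 0) :
    cs.geomRep (cs.simple i) (Pi.single j 1) =
      Pi.single j 1 + (2 : ℂ) • Pi.single i 1 := by
  rw [geomRep_simple_apply, M.coroot_single, CoxeterMatrix.halfRoot, h]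
  simp only [Nat.cast_zero, div_zero, Complex.exp_zero, inv_one]
  module

theorem geomRep_wordProd_apply_of_notMem {b : B} {ω : List B} (hb : b ∉ ω) (v : B → ℂ) :
    cs.geomRep (cs.wordProd ω) v b = v b := by
  induction ω with
  | nil => simp
  | cons i ω ih =>
    simp only [List.mem_cons, not_or] at hb
    rw [wordProd_cons, map_mul, Module.End.mul_apply, geomRep_simple_apply]
    simp [ih hb.2, hb.1]

/-- In a Coxeter group, a product of two distinct simple reflections with finite label has order equal
to that label. -/
theorem orderOf_simple_mul_simple {i j : B} (hij : i ≠ j) (h0 : M i j ≠ 0) :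
    orderOf (cs.simple i * cs.simple j) = M i j := by
  refine Nat.dvd_antisymm (orderOf_dvd_of_pow_eq_one (cs.simple_mul_simple_pow i j)) ?_
  refine (M.isPrimitiveRoot_halfRoot_sq h0).dvd_of_pow_eq_one _ ?_
  set ξ := M.halfRoot i j with hξ
  have hξ0 : ξ ≠ 0 := Complex.exp_ne_zero _
  have hji : M.halfRoot j i = ξ := by rw [hξ, CoxeterMatrix.halfRoot, M.symmetric]; rfl
  let v : B → ℂ := ξ • Pi.single i 1 + Pi.single j 1
  have hv : cs.geomRep (cs.simple i * cs.simple j) v = ξ ^ 2 • v := by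
    simp only [v, map_mul, Module.End.mul_apply, geomRep_simple_apply, map_add, map_sub, map_smul,
      M.coroot_single_self, M.coroot_single, hji, ← hξ]
    match_scalars <;> simp <;> field_simp <;> ring
  have hpow : ∀ k, cs.geomRep ((cs.simple i * cs.simple j) ^ k) v = (ξ ^ 2) ^ k • v := by
    intro k
    induction k with
    | zero => simp
    | succ k ih => rw [pow_succ, map_mul, Module.End.mul_apply, hv, map_smul, ih, smul_smul,
        pow_succ' _ k]
  have := congrFun (hpow (orderOf (cs.simple i * cs.simple j))) j
  rw [pow_orderOf_eq_one] at this
  simpa [v, hij.symm] using this.symm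

end GeometricRepresentation

section InversionParity

open scoped Classical in
/-- The action of a simple reflection on pairs of a group element and a sign, which conjugates the
element and flips the sign exactly at the reflection itself. -/
noncomputable def parityReflection (i : B) : Function.End (W × ZMod 2) := fun p =>
  (cs.simple i * p.1 * (cs.simple i)⁻¹, p.2 + if p.1 = cs.simple i then 1 else 0)

open scoped Classical in
/-- A word acts by conjugation on the first component, and on the sign by the multiplicity in its
right inversion sequence. -/
theorem prod_map_parityReflection (ω : List B) (p : W × ZMod 2) :
    (ω.map cs.parityReflection).prod p =
      (cs.wordProd ω * p.1 * (cs.wordProd ω)⁻¹, p.2 + (cs.rightInvSeq ω).count p.1) := by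
  induction ω with
  | nil =>
    simp only [List.map_nil, List.prod_nil, wordProd_nil, rightInvSeq_nil, one_mul, inv_one,
      mul_one, List.count_nil, Nat.cast_zero, add_zero]
    rfl
  | cons i ω ih =>
    rw [List.map_cons, List.prod_cons]
    change cs.parityReflection i ((ω.map cs.parityReflection).prod p) = _
    rw [ih, parityReflection, rightInvSeq, wordProd_cons, List.count_cons]
    have : cs.wordProd ω * p.1 * (cs.wordProd ω)⁻¹ = cs.simple i ↔
        (cs.wordProd ω)⁻¹ * cs.simple i * cs.wordProd ω = p.1 := by
      constructor
      · intro h; rw [← h]; group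
      · intro h; rw [← h]; group
    simp only [this, beq_iff_eq]
    refine Prod.ext ?_ ?_
    · simp [mul_assoc]
    · split_ifs <;> simp [add_assoc]

theorem leftInvSeq_alternatingWord_two_mul (i j : B) :
    cs.leftInvSeq (alternatingWord i j (2 * M i j)) =
      (cs.leftInvSeq (alternatingWord i j (2 * M i j))).take (M i j) ++
        (cs.leftInvSeq (alternatingWord i j (2 * M i j))).take (M i j) := by
  refine List.ext_getElem (by simp; omega) fun k h₁ h₂ => ?_
  simp only [length_leftInvSeq, length_alternatingWord] at h₁
  rw [List.getElem_append]
  split_ifs with hk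
  · rw [List.getElem_take]
  · simp only [List.length_take, length_leftInvSeq, length_alternatingWord] at hk ⊢
    rw [List.getElem_take, getElem_leftInvSeq_alternatingWord _ _ _ _ _ h₁,
      getElem_leftInvSeq_alternatingWord _ _ _ _ _ (by omega), prod_alternatingWord_eq_mul_pow,
      prod_alternatingWord_eq_mul_pow]
    obtain ⟨d, rfl⟩ : ∃ d, k = M i j + d := ⟨k - M i j, by omega⟩
    have e₁ : (2 * (M i j + d) + 1) / 2 = M i j + d := by omega
    have e₂ : (2 * (M i j + d - min (M i j) (2 * M i j)) + 1) / 2 = d := by omega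
    rw [e₁, e₂, pow_add, simple_mul_simple_pow', one_mul]
    simp

theorem reverse_alternatingWord_two_mul (i j : B) (p : ℕ) :
    (alternatingWord i j (2 * p)).reverse = alternatingWord j i (2 * p) := by
  refine List.ext_getElem (by simp) fun k h₁ h₂ => ?_
  simp only [length_alternatingWord] at h₂
  rw [List.getElem_reverse, getElem_alternatingWord, getElem_alternatingWord _ _ _ _ h₂]
  · simp only [length_alternatingWord, Nat.even_iff]
    split_ifs <;> first | rfl | omega
  · simp; omega

theorem prod_map_alternatingWord_two_mul {G : Type*} [Monoid G] (f : B → G) (i j : B) (p : ℕ) :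
    ((alternatingWord i j (2 * p)).map f).prod = (f i * f j) ^ p := by
  induction p with
  | zero => simp [alternatingWord]
  | succ p ih =>
    rw [mul_add, mul_one, alternatingWord, alternatingWord, pow_succ, ← ih]
    simp

theorem isLiftable_parityReflection : M.IsLiftable cs.parityReflection := by
  classical
  intro i j
  rw [← prod_map_alternatingWord_two_mul]
  funext p
  rw [prod_map_parityReflection, ← reverse_alternatingWord_two_mul, rightInvSeq_reverse,
    List.count_reverse, M.symmetric, leftInvSeq_alternatingWord_two_mul,
    reverse_alternatingWord_two_mul, ← M.symmetric, wordProd, prod_map_alternatingWord_two_mul,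
    simple_mul_simple_pow, List.count_append, Nat.cast_add, CharTwo.add_self_eq_zero,
    one_mul, inv_one, mul_one, add_zero]
  rfl

open scoped Classical in
/-- The parity of the multiplicity of `t` in the right inversion sequence depends only on the element
represented by the word. -/
theorem count_rightInvSeq_eq_of_wordProd_eq {ω ω' : List B}
    (h : cs.wordProd ω = cs.wordProd ω') (t : W) :
    ((cs.rightInvSeq ω).count t : ZMod 2) = (cs.rightInvSeq ω').count t := by
  have key : ∀ ω : List B, cs.lift ⟨_, cs.isLiftable_parityReflection⟩ (cs.wordProd ω) =
      (ω.map cs.parityReflection).prod := by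
    intro ω
    rw [wordProd, map_list_prod, List.map_map]
    congr 2
    funext i
    exact cs.lift_apply_simple _ i
  have := key ω
  rw [h, key] at this
  simpa [prod_map_parityReflection, eq_comm] using congrArg Prod.snd (congrFun this (t, 0))

/-- A word whose right inversion sequence has no repetition is reduced. -/
theorem isReduced_of_nodup_rightInvSeq {ω : List B} (hω : (cs.rightInvSeq ω).Nodup) :
    cs.IsReduced ω := by
  classical
  obtain ⟨ω', hω', h⟩ := cs.exists_isReduced (cs.wordProd ω)
  refine le_antisymm (cs.length_wordProd_le ω) ?_
  rw [h, hω'.eq, ← cs.length_rightInvSeq ω, ← cs.length_rightInvSeq ω']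
  refine (hω.subperm fun t ht => ?_).length_le
  have := cs.count_rightInvSeq_eq_of_wordProd_eq h t
  rw [List.count_eq_one_of_mem hω ht] at this
  by_contra hmem
  rw [List.count_eq_zero_of_not_mem hmem] at this
  simp at this

/-- A word whose left inversion sequence has no repetition is reduced. -/
theorem isReduced_of_nodup_leftInvSeq {ω : List B} (hω : (cs.leftInvSeq ω).Nodup) :
    cs.IsReduced ω := by
  rw [← isReduced_reverse_iff]
  refine cs.isReduced_of_nodup_rightInvSeq ?_
  rwa [rightInvSeq_reverse, List.nodup_reverse]

end InversionParity

section ReducedWords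
variable [Fintype B] [DecidableEq B]

theorem nodup_leftInvSeq_take_alternatingWord {i j : B} (hij : i ≠ j) :
    (cs.leftInvSeq ((alternatingWord i j (2 * M i j)).take (M i j))).Nodup := by
  rw [leftInvSeq_take, List.nodup_iff_injective_getElem]
  rintro ⟨k, hk⟩ ⟨l, hl⟩ h
  simp only [List.length_take, length_leftInvSeq, length_alternatingWord, lt_inf_iff] at hk hl
  simp only [List.getElem_take] at h
  rw [getElem_leftInvSeq_alternatingWord _ _ _ _ _ hk.2,
    getElem_leftInvSeq_alternatingWord _ _ _ _ _ hl.2, prod_alternatingWord_eq_mul_pow,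
    prod_alternatingWord_eq_mul_pow] at h
  have e : ∀ k, (2 * k + 1) / 2 = k := by omega
  have o : ∀ k, ¬ Even (2 * k + 1) := by simp
  simp only [o, e, if_false, mul_right_inj] at h
  have ho := cs.orderOf_simple_mul_simple hij.symm (by rw [← M.symmetric]; omega)
  rw [← M.symmetric] at ho
  exact Fin.ext (pow_injOn_Iio_orderOf (by simpa [ho] using hk.1) (by simpa [ho] using hl.1) h)

/-- If `b` is joined to `x` by the label `∞` and is neither `i` nor `j`, then prefixing `x b` to the
longest alternating word in `i` and `j` gives a reduced word. -/
theorem isReduced_cons_cons_take_alternatingWord {b i j x : B} (hij : i ≠ j)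
    (hbi : b ≠ i) (hbj : b ≠ j) (hx : M b x = 0) :
    cs.IsReduced (x :: b :: (alternatingWord i j (2 * M i j)).take (M i j)) := by
  have hbx : b ≠ x := by
    rintro rfl
    simp at hx
  have hfix : ∀ t ∈ cs.leftInvSeq ((alternatingWord i j (2 * M i j)).take (M i j)),
      ∀ v, cs.geomRep t v b = v b := by
    intro t ht v
    rw [leftInvSeq_take] at ht
    obtain ⟨k, hk, rfl⟩ := List.getElem_of_mem (List.mem_of_mem_take ht)
    simp only [length_leftInvSeq, length_alternatingWord] at hk
    rw [getElem_leftInvSeq_alternatingWord _ _ _ _ _ hk]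
    refine cs.geomRep_wordProd_apply_of_notMem (fun hb => ?_) v
    obtain ⟨l, hl, h⟩ := List.getElem_of_mem hb
    rw [getElem_alternatingWord _ _ _ _ (by simpa using hl)] at h
    split_ifs at h
    exacts [hbj h.symm, hbi h.symm]
  refine cs.isReduced_of_nodup_leftInvSeq ?_
  have hinj := fun y => (MulAut.conj (cs.simple y)).injective
  simp only [leftInvSeq]
  rw [List.nodup_cons]
  refine ⟨?_, (List.nodup_cons.2 ⟨?_, (cs.nodup_leftInvSeq_take_alternatingWord hij).map
    (hinj b)⟩).map (hinj x)⟩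
  · intro hmem
    obtain ⟨u, hu, h⟩ := List.mem_map.1 hmem
    have hux : u = cs.simple x := hinj x (by simp [h])
    subst hux
    rcases List.mem_cons.1 hu with hu | hu
    · have := cs.geomRep_wordProd_apply_of_notMem (b := b) (ω := [x]) (by simpa using hbx)
        (Pi.single b 1)
      rw [wordProd_singleton, hu, geomRep_simple_single_self] at this
      norm_num at this
    · obtain ⟨t, ht, h⟩ := List.mem_map.1 hu
      have ht' : t = cs.simple b * cs.simple x * cs.simple b := by
        rw [← h]
        simp [mul_assoc]
      have := hfix t ht (Pi.single x 1)
      rw [ht'] at this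
      simp only [map_mul, Module.End.mul_apply, map_add, map_smul, map_neg,
        cs.geomRep_simple_single_of_eq_zero hx,
        cs.geomRep_simple_single_of_eq_zero ((M.symmetric x b).trans hx),
        geomRep_simple_single_self] at this
      norm_num [hbx] at this
  · intro hmem
    obtain ⟨t, ht, h⟩ := List.mem_map.1 hmem
    have htb : t = cs.simple b := hinj b (by simp [h])
    have := hfix t ht (Pi.single b 1)
    rw [htb, geomRep_simple_single_self] at this
    norm_num at this

end ReducedWords

end CoxeterSystem

theorem altPairs_succ {n : ℕ} (a b : Fin n) (k : ℕ) :
    altPairs a b (k + 1) = altPairs a b k ++ [a, b] := by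
  simp [altPairs, List.replicate_succ']

theorem altPairs_eq_alternatingWord {n : ℕ} (a b : Fin n) (k : ℕ) :
    altPairs a b k = alternatingWord a b (2 * k) := by
  induction k with
  | zero => rfl
  | succ k ih =>
    rw [altPairs_succ, ih, mul_add, mul_one, alternatingWord, alternatingWord]
    simp

theorem wWord_eq {n : ℕ} (a b c : Fin n) (m : ℕ) :
    wWord a b c m =
      a :: b :: if Even m then alternatingWord a c m else alternatingWord c a m := by
  obtain ⟨k, rfl | rfl⟩ := Nat.even_or_odd' m
  · simp [wWord, altPairs_eq_alternatingWord]
  · have h : (2 * k + 1) % 2 = 1 := by omega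
    simp [wWord, altPairs_eq_alternatingWord, h, alternatingWord]

theorem wWord''_eq {n : ℕ} (a b c : Fin n) (m : ℕ) :
    wWord'' a b c m =
      a :: b :: if Even m then alternatingWord c a m else alternatingWord a c m := by
  obtain ⟨k, rfl | rfl⟩ := Nat.even_or_odd' m
  · simp [wWord'', altPairs_eq_alternatingWord]
  · have h : (2 * k + 1) % 2 = 1 := by omega
    simp [wWord'', altPairs_eq_alternatingWord, h, alternatingWord]

theorem length_wWord {n : ℕ} (a b c : Fin n) (m : ℕ) : (wWord a b c m).length = m + 2 := by
  rw [wWord_eq]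
  split_ifs <;> simp

theorem length_wWord'' {n : ℕ} (a b c : Fin n) (m : ℕ) : (wWord'' a b c m).length = m + 2 := by
  rw [wWord''_eq]
  split_ifs <;> simp

theorem wWord_ne_wWord'' {n : ℕ} {a b c : Fin n} (hac : a ≠ c) {m : ℕ} (hm : 0 < m) :
    wWord a b c m ≠ wWord'' a b c m := by
  have hne : alternatingWord a c m ≠ alternatingWord c a m := by
    obtain ⟨k, rfl⟩ := Nat.exists_eq_add_of_lt hm
    rw [zero_add, alternatingWord, alternatingWord, List.concat_eq_append, List.concat_eq_append]
    intro h
    have := (List.append_inj' h rfl).2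
    simp [hac.symm] at this
  rw [wWord_eq, wWord''_eq]
  split_ifs
  · simpa using hne
  · simpa using hne.symm

theorem wordProd_wWord_eq {n : ℕ} {M : CoxeterMatrix (Fin n)} {W : Type*} [Group W]
    (cs : CoxeterSystem M W) (a b c : Fin n) :
    cs.wordProd (wWord a b c (M a c)) = cs.wordProd (wWord'' a b c (M a c)) := by
  have h := cs.wordProd_braidWord_eq a c
  rw [braidWord, braidWord, M.symmetric c a] at h
  rw [wWord_eq, wWord''_eq]
  split_ifs <;> simp only [wordProd_cons, h]

theorem isReduced_wWord {n : ℕ} {M : CoxeterMatrix (Fin n)} {W : Type*} [Group W]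
    (cs : CoxeterSystem M W) {a b c : Fin n} (hab : M a b = 0) (hbc : b ≠ c) (hac : a ≠ c)
    (h0 : M a c ≠ 0) : cs.IsReduced (wWord a b c (M a c)) := by
  have hba : b ≠ a := by
    rintro rfl
    simp at hab
  have := cs.isReduced_cons_cons_take_alternatingWord hac hba hbc
    ((M.symmetric b a).trans hab)
  rwa [listTake_alternatingWord _ _ _ _ (by omega), ← wWord_eq] at this

/-- Assume `M 1 2 = 0`, `M 2 3 = 0` and `m = M 1 3 ≥ 2` is finite (generators are indexed by
`0, 1, 2` in `Fin n`). Then the words `w` and `w''` are distinct words of length `m + 2`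
representing the same element of `G`, and both are geodesic (reduced). In particular some
element of `G` has two distinct reduced expressions, so the geodesic language strictly
contains the shortlex language. -/
theorem two_reduced_words {n : ℕ} (hn : 3 ≤ n) (M : CoxeterMatrix (Fin n))
    {W : Type*} [Group W] (cs : CoxeterSystem M W)
    (h12 : M ⟨0, by omega⟩ ⟨1, by omega⟩ = 0)
    (h23 : M ⟨1, by omega⟩ ⟨2, by omega⟩ = 0)
    (m : ℕ) (h13 : M ⟨0, by omega⟩ ⟨2, by omega⟩ = m) (hm : 2 ≤ m) :
    wWord (⟨0, by omega⟩ : Fin n) ⟨1, by omega⟩ ⟨2, by omega⟩ m ≠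
      wWord'' (⟨0, by omega⟩ : Fin n) ⟨1, by omega⟩ ⟨2, by omega⟩ m ∧
    (wWord (⟨0, by omega⟩ : Fin n) ⟨1, by omega⟩ ⟨2, by omega⟩ m).length = m + 2 ∧
    (wWord'' (⟨0, by omega⟩ : Fin n) ⟨1, by omega⟩ ⟨2, by omega⟩ m).length = m + 2 ∧
    cs.wordProd (wWord (⟨0, by omega⟩ : Fin n) ⟨1, by omega⟩ ⟨2, by omega⟩ m) =
      cs.wordProd (wWord'' (⟨0, by omega⟩ : Fin n) ⟨1, by omega⟩ ⟨2, by omega⟩ m) ∧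
    cs.length (cs.wordProd (wWord (⟨0, by omega⟩ : Fin n) ⟨1, by omega⟩ ⟨2, by omega⟩ m)) =
      m + 2 ∧
    ∃ l l' : List (Fin n), l ≠ l' ∧ cs.IsReduced l ∧ cs.IsReduced l' ∧
      cs.wordProd l = cs.wordProd l' := by
  subst h13
  have h02 : (⟨0, by omega⟩ : Fin n) ≠ ⟨2, by omega⟩ := by simp
  have hne := wWord_ne_wWord'' (b := (⟨1, by omega⟩ : Fin n)) h02 (m := M _ _)
    (lt_of_lt_of_le two_pos hm)
  have hred := isReduced_wWord cs h12 (c := ⟨2, by omega⟩) (by simp) h02 (by omega)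
  have hprod := wordProd_wWord_eq cs ⟨0, by omega⟩ ⟨1, by omega⟩ ⟨2, by omega⟩
  have hlen := hred.eq
  rw [length_wWord] at hlen
  refine ⟨hne, length_wWord _ _ _ _, length_wWord'' _ _ _ _, hprod, hlen,
    _, _, hne, hred, ?_, hprod⟩
  rw [CoxeterSystem.IsReduced, ← hprod, hlen, length_wWord'']
end
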